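/- arXiv:math/0401391 — 5 statements merged into one kernel-verified Lean document; each statement's English description precedes it below -/
import Mathlib

section
/- Let T be a polynomial with real coefficients of degree d ≥ 1 and let x ∈ ℝ be such that the polynomial T − x has d distinct real roots λ₁, …, λ_d. Then for every index i, Σ_{k ≠ i} 1/(T'(λ_k)·(λ_k − λ_i)) = T''(λ_i) / (2·T'(λ_i)²). -/
open Polynomial

namespace Lagrange

variable {F ι : Type*} [Field F] [DecidableEq ι] {s : Finset ι} {v : ι → F}

theorem basis_eq_nodalWeight_mul_nodal_erase (k : ι) :
    Lagrange.basis s v k = C (nodalWeight s v k) * nodal (s.erase k) v := by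
  simp_rw [Lagrange.basis, basisDivisor, nodalWeight, nodal, Finset.prod_mul_distrib, map_prod]

theorem sub_mul_eval_derivative_nodal_erase {i k : ι} (hi : i ∈ s) (hk : k ∈ s) (hik : i ≠ k) :
    (v i - v k) * (derivative (nodal (s.erase k) v)).eval (v i) =
      (derivative (nodal s v)).eval (v i) := by
  have h0 : (nodal (s.erase k) v).eval (v i) = 0 :=
    eval_nodal_at_node (Finset.mem_erase.2 ⟨hik, hi⟩)
  rw [nodal_eq_mul_nodal_erase hk]
  simp [h0]

theorem eval_derivative_derivative_nodal {i : ι} (hi : i ∈ s) :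
    (derivative (derivative (nodal s v))).eval (v i) =
      2 * (derivative (nodal (s.erase i) v)).eval (v i) := by
  rw [nodal_eq_mul_nodal_erase hi]
  simp [two_mul]

/-- Differentiating the partition of unity `∑ k, basis s v k = 1` at the node `v i`. -/
theorem sum_nodalWeight_div_sub (hv : Set.InjOn v s) (h2 : (2 : F) ≠ 0) {i : ι} (hi : i ∈ s) :
    ∑ k ∈ s.erase i, nodalWeight s v k / (v k - v i) =
      (derivative (derivative (nodal s v))).eval (v i) * nodalWeight s v i ^ 2 / 2 := by
  have hw : nodalWeight s v i ≠ 0 := nodalWeight_ne_zero hv hi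
  have hN : (derivative (nodal s v)).eval (v i) = (nodalWeight s v i)⁻¹ := by
    rw [nodalWeight_eq_eval_derivative_nodal hi, inv_inv]
  have hsum := congrArg (fun p => (derivative p).eval (v i)) (sum_basis hv ⟨i, hi⟩)
  simp only [basis_eq_nodalWeight_mul_nodal_erase, derivative_sum, derivative_C_mul,
    eval_finsetSum, eval_C_mul, derivative_one, eval_zero] at hsum
  rw [← Finset.add_sum_erase _ _ hi] at hsum
  have hterm : ∀ k ∈ s.erase i,
      nodalWeight s v k / (v k - v i) = -nodalWeight s v i *
        (nodalWeight s v k * (derivative (nodal (s.erase k) v)).eval (v i)) := by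
    intro k hk
    obtain ⟨hki, hks⟩ := Finset.mem_erase.1 hk
    have hne : v k - v i ≠ 0 := sub_ne_zero.2 fun h => hki (hv hks hi h)
    have hder := sub_mul_eval_derivative_nodal_erase (v := v) hi hks hki.symm
    rw [hN, ← one_div, eq_div_iff hw] at hder
    rw [div_eq_iff hne]
    linear_combination -nodalWeight s v k * hder
  rw [Finset.sum_congr rfl hterm, ← Finset.mul_sum, eval_derivative_derivative_nodal hi,
    eq_div_iff h2]
  linear_combination -2 * nodalWeight s v i * hsum

end Lagrange

/-- If `T - x` has `d` distinct real roots `Λ 1, …, Λ d`, then for every index `i`,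
`∑_{k ≠ i} 1/(T'(Λ k)·(Λ k - Λ i)) = T''(Λ i)/(2 T'(Λ i)²)`. -/
theorem sum_inv_derivRoot_mul_sub_root
    (d : ℕ) (hd : 1 ≤ d) (T : Polynomial ℝ) (hdeg : T.natDegree = d)
    (x : ℝ) (Λ : Fin d → ℝ) (hinj : Function.Injective Λ)
    (hfact : T - C x = C T.leadingCoeff * ∏ k : Fin d, (X - C (Λ k)))
    (i : Fin d) :
    ∑ k ∈ Finset.univ.erase i, 1 / ((derivative T).eval (Λ k) * (Λ k - Λ i)) =
      (derivative (derivative T)).eval (Λ i) / (2 * (derivative T).eval (Λ i) ^ 2) := by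
  have hc : T.leadingCoeff ≠ 0 := by
    rw [leadingCoeff_ne_zero]
    rintro rfl
    simp at hdeg
    omega
  have hT : derivative T = C T.leadingCoeff * derivative (Lagrange.nodal Finset.univ Λ) := by
    simpa [Lagrange.nodal] using congrArg derivative hfact
  have hinv (k : Fin d) : ((derivative T).eval (Λ k))⁻¹ =
      T.leadingCoeff⁻¹ * Lagrange.nodalWeight Finset.univ Λ k := by
    rw [hT, eval_C_mul, mul_inv,
      Lagrange.nodalWeight_eq_eval_derivative_nodal (Finset.mem_univ k)]
  have hterm (k : Fin d) : 1 / ((derivative T).eval (Λ k) * (Λ k - Λ i)) =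
      T.leadingCoeff⁻¹ * (Lagrange.nodalWeight Finset.univ Λ k / (Λ k - Λ i)) := by
    rw [one_div, mul_inv, hinv]
    ring
  have hT2 : (derivative (derivative T)).eval (Λ i) = T.leadingCoeff *
      (derivative (derivative (Lagrange.nodal Finset.univ Λ))).eval (Λ i) := by
    rw [hT, derivative_C_mul, eval_C_mul]
  simp_rw [hterm]
  rw [← Finset.mul_sum, Lagrange.sum_nodalWeight_div_sub hinj.injOn two_ne_zero
    (Finset.mem_univ i), div_eq_mul_inv _ (2 * _), mul_inv, ← inv_pow, hinv, hT2]
  field_simp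
end

section
/- Let T be a polynomial with real coefficients of degree d ≥ 1 and let x ∈ ℝ be such that the polynomial T − x has d distinct real roots λ₁, …, λ_d. Then for every index i, Σ_{k ≠ i} 1/(λ_i − λ_k)² = ( (1/2)·T''(λ_i)² − (2/3)·T'(λ_i)·T'''(λ_i) ) / (2·T'(λ_i)²). -/
open Polynomial

/-- The sum of the inverse squared distances from `y` to the roots of `P = ∏ (X - f k)`, times
`P(y)²`, is `P'(y)² - P(y) P''(y)`. -/
theorem sum_one_div_sq_mul_eval_prod_sq {K ι : Type*} [Field K] (s : Finset ι) (f : ι → K)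
    (y : K) (hy : ∀ k ∈ s, y - f k ≠ 0) :
    (∑ k ∈ s, 1 / (y - f k) ^ 2) * (∏ k ∈ s, (X - C (f k))).eval y ^ 2 =
      (derivative (∏ k ∈ s, (X - C (f k)))).eval y ^ 2 -
        (∏ k ∈ s, (X - C (f k))).eval y *
          (derivative (derivative (∏ k ∈ s, (X - C (f k))))).eval y := by
  classical
  induction s using Finset.induction_on with
  | empty => simp
  | insert a s ha ih =>
    have ha0 : y - f a ≠ 0 := hy a (Finset.mem_insert_self a s)
    have ih := ih fun k hk => hy k (Finset.mem_insert_of_mem hk)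
    rw [Finset.sum_insert ha, Finset.prod_insert ha]
    generalize ∏ k ∈ s, (X - C (f k)) = R at ih ⊢
    simp only [derivative_mul, derivative_add, derivative_sub, derivative_X, derivative_C,
      eval_add, eval_mul, eval_sub, eval_X, eval_C, sub_zero, one_mul]
    have hcancel : 1 / (y - f a) ^ 2 * (y - f a) ^ 2 = 1 := by field_simp
    linear_combination (y - f a) ^ 2 * ih + R.eval y ^ 2 * hcancel

/-- If `T - x` has `d` distinct real roots `Λ 1, …, Λ d`, then for every index `i`,
`∑_{k ≠ i} 1/(Λ i - Λ k)² = ((1/2)T''(Λ i)² - (2/3)T'(Λ i)T'''(Λ i)) / (2 T'(Λ i)²)`. -/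
theorem sum_inv_sq_root_differences
    (d : ℕ) (hd : 1 ≤ d) (T : Polynomial ℝ) (hdeg : T.natDegree = d)
    (x : ℝ) (Λ : Fin d → ℝ) (hinj : Function.Injective Λ)
    (hfact : T - C x = C T.leadingCoeff * ∏ k : Fin d, (X - C (Λ k)))
    (i : Fin d) :
    ∑ k ∈ Finset.univ.erase i, 1 / (Λ i - Λ k) ^ 2 =
      ((1 / 2) * (derivative (derivative T)).eval (Λ i) ^ 2 -
        (2 / 3) * (derivative T).eval (Λ i) *
          (derivative (derivative (derivative T))).eval (Λ i)) /
        (2 * (derivative T).eval (Λ i) ^ 2) := by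
  have hne : ∀ k ∈ Finset.univ.erase i, Λ i - Λ k ≠ 0 := fun k hk =>
    sub_ne_zero.2 fun h => Finset.ne_of_mem_erase hk (hinj h).symm
  have ha : T.leadingCoeff ≠ 0 := by
    rw [Ne, leadingCoeff_eq_zero]
    rintro rfl
    simp at hdeg
    omega
  have hsum := sum_one_div_sq_mul_eval_prod_sq (Finset.univ.erase i) Λ (Λ i) hne
  have hP : (∏ k ∈ Finset.univ.erase i, (X - C (Λ k))).eval (Λ i) ≠ 0 := by
    rw [eval_prod, Finset.prod_ne_zero_iff]
    simpa using hne
  rw [← Finset.mul_prod_erase _ _ (Finset.mem_univ i), sub_eq_iff_eq_add] at hfact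
  generalize ∏ k ∈ Finset.univ.erase i, (X - C (Λ k)) = P at hfact hsum hP
  generalize T.leadingCoeff = a at hfact ha
  subst hfact
  simp only [derivative_mul, derivative_add, derivative_sub, derivative_X, derivative_C,
    eval_add, eval_mul, eval_sub, eval_X, eval_C, sub_zero, sub_self, zero_mul, zero_add, add_zero,
    one_mul]
  rw [eq_div_iff (by positivity)]
  linear_combination 2 * a ^ 2 * hsum
end

section
/- Let T be a polynomial with real coefficients of degree d ≥ 1 and let x ∈ ℝ be such that the polynomial T − x has d distinct real roots λ₁, …, λ_d. Then for every index i, (T''(λ_i)/(2·T'(λ_i)))² + Σ_{k ≠ i} 1/(λ_i − λ_k)² = −(1/3)·S(T)(λ_i), where S(T) = T'''/T' − (3/2)·(T''/T')² is the Schwarzian derivative of T; in particular S(T)(λ_i) ≤ 0. -/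
open Polynomial

/-- The Schwarzian derivative of a real polynomial, `S(T) = T'''/T' - (3/2)(T''/T')²`,
evaluated at a point. -/
noncomputable def polySchwarzian (T : Polynomial ℝ) (y : ℝ) : ℝ :=
  (derivative (derivative (derivative T))).eval y / (derivative T).eval y -
    (3 / 2) * ((derivative (derivative T)).eval y / (derivative T).eval y) ^ 2

/-- Logarithmic differentiation of a product of linear factors, to second order, away from
its roots. -/
lemma eval_derivative_prod_X_sub_C {ι K : Type*} [Field K] (s : Finset ι) (a : ι → K) (y : K)
    (h : ∀ k ∈ s, y - a k ≠ 0) :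
    (derivative (∏ k ∈ s, (X - C (a k)))).eval y =
        (∏ k ∈ s, (X - C (a k))).eval y * ∑ k ∈ s, 1 / (y - a k) ∧
      (derivative (derivative (∏ k ∈ s, (X - C (a k))))).eval y =
        (∏ k ∈ s, (X - C (a k))).eval y *
          ((∑ k ∈ s, 1 / (y - a k)) ^ 2 - ∑ k ∈ s, 1 / (y - a k) ^ 2) := by
  classical
  induction s using Finset.induction_on with
  | empty => simp
  | insert j s hj ih =>
    obtain ⟨h₁, h₂⟩ := ih fun k hk => h k (Finset.mem_insert_of_mem hk)
    have hy := h j (Finset.mem_insert_self j s)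
    rw [Finset.prod_insert hj, Finset.sum_insert hj, Finset.sum_insert hj]
    simp only [derivative_mul, derivative_add, derivative_sub, derivative_X, derivative_C,
      eval_add, eval_mul, eval_sub, eval_X, eval_C, sub_zero, one_mul, h₁, h₂]
    constructor
    · field_simp
    · field_simp
      ring

/-- If `T - x` has `d` distinct real roots `Λ 1, …, Λ d`, then for every index `i`,
`(T''(Λ i)/(2T'(Λ i)))² + ∑_{k ≠ i} 1/(Λ i - Λ k)² = -(1/3)·S(T)(Λ i)`;
in particular `S(T)(Λ i) ≤ 0`. -/
theorem schwarzian_nonpos_at_roots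
    (d : ℕ) (hd : 1 ≤ d) (T : Polynomial ℝ) (hdeg : T.natDegree = d)
    (x : ℝ) (Λ : Fin d → ℝ) (hinj : Function.Injective Λ)
    (hfact : T - C x = C T.leadingCoeff * ∏ k : Fin d, (X - C (Λ k)))
    (i : Fin d) :
    ((derivative (derivative T)).eval (Λ i) / (2 * (derivative T).eval (Λ i))) ^ 2 +
        ∑ k ∈ Finset.univ.erase i, 1 / (Λ i - Λ k) ^ 2 =
      -(1 / 3) * polySchwarzian T (Λ i) ∧
    polySchwarzian T (Λ i) ≤ 0 := by
  have hne : ∀ k ∈ Finset.univ.erase i, Λ i - Λ k ≠ 0 := fun k hk =>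
    sub_ne_zero.mpr fun h => Finset.ne_of_mem_erase hk (hinj h).symm
  obtain ⟨h₁, h₂⟩ := eval_derivative_prod_X_sub_C (Finset.univ.erase i) Λ (Λ i) hne
  have hP : (∏ k ∈ Finset.univ.erase i, (X - C (Λ k))).eval (Λ i) ≠ 0 := by
    rw [eval_prod]
    exact Finset.prod_ne_zero_iff.mpr fun k hk => by simpa using hne k hk
  have hc : T.leadingCoeff ≠ 0 := by
    rw [Ne, leadingCoeff_eq_zero]
    rintro rfl
    rw [natDegree_zero] at hdeg
    omega
  have hT : T = C T.leadingCoeff *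
      ((X - C (Λ i)) * ∏ k ∈ Finset.univ.erase i, (X - C (Λ k))) + C x := by
    rw [Finset.mul_prod_erase _ (fun k => X - C (Λ k)) (Finset.mem_univ i), ← hfact, sub_add_cancel]
  generalize (∏ k ∈ Finset.univ.erase i, (X - C (Λ k))) = Q at *
  generalize T.leadingCoeff = c at *
  have hmain : ((derivative (derivative T)).eval (Λ i) / (2 * (derivative T).eval (Λ i))) ^ 2 +
      ∑ k ∈ Finset.univ.erase i, 1 / (Λ i - Λ k) ^ 2 = -(1 / 3) * polySchwarzian T (Λ i) := by
    simp only [polySchwarzian, hT, derivative_mul, derivative_add, derivative_sub, derivative_X,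
      derivative_C, eval_add, eval_mul, eval_sub, eval_X, eval_C, sub_self, sub_zero, one_mul, zero_mul, zero_add, add_zero, h₁, h₂]
    generalize ∑ k ∈ Finset.univ.erase i, 1 / (Λ i - Λ k) = s₁
    generalize ∑ k ∈ Finset.univ.erase i, 1 / (Λ i - Λ k) ^ 2 = s₂
    field_simp
    ring
  refine ⟨hmain, ?_⟩
  have hsum : 0 ≤ ∑ k ∈ Finset.univ.erase i, 1 / (Λ i - Λ k) ^ 2 :=
    Finset.sum_nonneg fun k _ => by positivity
  have hsq := sq_nonneg
    ((derivative (derivative T)).eval (Λ i) / (2 * (derivative T).eval (Λ i)))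
  linarith
end

section
/- Let T be a polynomial with real coefficients of degree d ≥ 1 and let x ∈ ℝ be such that the polynomial T − x has d distinct real roots λ₁, …, λ_d. Let H be the d × d real matrix with entries H_{ij} = 1/(λ_i − λ_j) for i ≠ j and H_{ii} = T''(λ_i)/(2·T'(λ_i)), let Λ = diag(λ₁, …, λ_d), and set Δ = HᵀH. Then Δ is positive semidefinite and [Λ, [Λ, Δ]] = 2·(E − I), where E is the d × d all-ones matrix, I is the identity matrix, and [A,B] = AB − BA. -/
open Polynomial Matrix

/-- The logarithmic derivative of a product of linear factors, away from its roots. -/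
lemma eval_derivative_prod_X_sub_C_div {K ι : Type*} [Field K] [DecidableEq ι]
    (s : Finset ι) (a : ι → K) (z : K) (hz : ∀ k ∈ s, z - a k ≠ 0) :
    (derivative (∏ k ∈ s, (X - C (a k)))).eval z / (∏ k ∈ s, (X - C (a k))).eval z =
      ∑ k ∈ s, 1 / (z - a k) := by
  rw [derivative_prod_finset, eval_finsetSum, Finset.sum_div]
  refine Finset.sum_congr rfl fun k hk => ?_
  have hne : ∏ j ∈ s.erase k, (z - a j) ≠ 0 :=
    Finset.prod_ne_zero_iff.mpr fun j hj => hz j (Finset.mem_of_mem_erase hj)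
  have hk' := hz k hk
  rw [← Finset.mul_prod_erase s _ hk]
  simp only [derivative_sub, derivative_X, derivative_C, sub_zero, mul_one, eval_mul, eval_prod,
    eval_sub, eval_X, eval_C]
  field_simp

/-- At a simple root `Λ i` of `T - x`, the quotient `T'' / (2 T')` is the sum of the inverse
differences to the other roots. -/
lemma eval_derivative_derivative_div_eq_sum {K ι : Type*} [Field K] [CharZero K] [Fintype ι]
    [DecidableEq ι] {T : K[X]} {x c : K} (hc : c ≠ 0) {Λ : ι → K} (hinj : Function.Injective Λ)
    (hfact : T - C x = C c * ∏ k, (X - C (Λ k))) (i : ι) :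
    (derivative (derivative T)).eval (Λ i) / (2 * (derivative T).eval (Λ i)) =
      ∑ k ∈ Finset.univ.erase i, 1 / (Λ i - Λ k) := by
  have hne : ∀ k ∈ Finset.univ.erase i, Λ i - Λ k ≠ 0 := fun k hk =>
    sub_ne_zero.mpr fun h => Finset.ne_of_mem_erase hk (hinj h).symm
  rw [← eval_derivative_prod_X_sub_C_div _ _ _ hne]
  rw [← Finset.mul_prod_erase _ _ (Finset.mem_univ i), sub_eq_iff_eq_add] at hfact
  set Q : K[X] := ∏ k ∈ Finset.univ.erase i, (X - C (Λ k)) with hQ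
  have hQ0 : Q.eval (Λ i) ≠ 0 := by
    simpa [hQ, eval_prod, Finset.prod_ne_zero_iff] using hne
  have h1 : (derivative T).eval (Λ i) = c * Q.eval (Λ i) := by
    simp [hfact]
  have h2 : (derivative (derivative T)).eval (Λ i) = 2 * c * (derivative Q).eval (Λ i) := by
    simp [hfact]
    ring
  rw [h1, h2]
  field_simp

/-- A matrix with off-diagonal entries `1 / (Λ i - Λ j)` and vanishing column sums has a Gram
matrix with off-diagonal entries `2 / (Λ i - Λ j) ^ 2`. -/
lemma sq_sub_mul_transpose_mul_self_apply {K ι : Type*} [Field K] [Fintype ι] [DecidableEq ι]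
    {Λ : ι → K} (hinj : Function.Injective Λ) {H : Matrix ι ι K}
    (hoff : ∀ i j, i ≠ j → H i j = 1 / (Λ i - Λ j)) (hcol : ∀ j, ∑ k, H k j = 0)
    {i j : ι} (hij : i ≠ j) :
    (Λ i - Λ j) ^ 2 * (Hᵀ * H) i j = 2 := by
  have hsub : ∀ {a b : ι}, a ≠ b → Λ a - Λ b ≠ 0 := fun h => sub_ne_zero.mpr (hinj.ne h)
  have hd := hsub hij
  have hd' := hsub hij.symm
  have hterm : ∀ k, (Λ i - Λ j) * (H k i * H k j) =
      H k i - H k j + ((if k = i then H i j else 0) - if k = j then H j i else 0) := by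
    intro k
    by_cases hki : k = i
    · subst hki
      rw [if_pos rfl, if_neg hij, hoff k j hij]
      field_simp
      ring
    by_cases hkj : k = j
    · subst hkj
      rw [if_neg hki, if_pos rfl, hoff k i hki]
      field_simp
      ring
    · have h1 := hsub hki
      have h2 := hsub hkj
      rw [if_neg hki, if_neg hkj, hoff k i hki, hoff k j hkj]
      field_simp
      ring
  have hsum : (Λ i - Λ j) * (Hᵀ * H) i j = H i j - H j i := by
    simp only [mul_apply, transpose_apply, Finset.mul_sum, hterm]
    simp [Finset.sum_add_distrib, Finset.sum_sub_distrib, hcol]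
  rw [sq, mul_assoc, hsum, hoff i j hij, hoff j i hij.symm]
  field_simp
  ring

/-- If `T - x` has `d` distinct real roots, `H` is the matrix of `FDF⁻¹` in the
eigenbasis of `J`, `Λm = diag(Λ)` and `Δ = HᵀH`, then `Δ` is positive semidefinite
and `[Λm, [Λm, Δ]] = 2(E - I)` where `E` is the all-ones matrix. -/
theorem laplacian_posSemidef_and_double_commutator
    (d : ℕ) (hd : 1 ≤ d) (T : Polynomial ℝ) (hdeg : T.natDegree = d)
    (x : ℝ) (Λ : Fin d → ℝ) (hinj : Function.Injective Λ)
    (hfact : T - C x = C T.leadingCoeff * ∏ k : Fin d, (X - C (Λ k)))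
    (H : Matrix (Fin d) (Fin d) ℝ)
    (hHoff : ∀ i j, i ≠ j → H i j = 1 / (Λ i - Λ j))
    (hHdiag : ∀ i, H i i =
      (derivative (derivative T)).eval (Λ i) / (2 * (derivative T).eval (Λ i))) :
    (Hᵀ * H).PosSemidef ∧
      (diagonal Λ * (diagonal Λ * (Hᵀ * H) - (Hᵀ * H) * diagonal Λ) -
          (diagonal Λ * (Hᵀ * H) - (Hᵀ * H) * diagonal Λ) * diagonal Λ) =
        (2 : ℝ) • (Matrix.of (fun _ _ => (1 : ℝ)) - (1 : Matrix (Fin d) (Fin d) ℝ)) := by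
  refine ⟨by simpa using posSemidef_conjTranspose_mul_self H, ?_⟩
  have hc : T.leadingCoeff ≠ 0 := by
    rw [Ne, leadingCoeff_eq_zero]
    rintro rfl
    simp at hdeg
    omega
  have hcol : ∀ j, ∑ k, H k j = 0 := by
    intro j
    rw [← Finset.add_sum_erase _ _ (Finset.mem_univ j), hHdiag j,
      eval_derivative_derivative_div_eq_sum hc hinj hfact j, ← Finset.sum_add_distrib]
    refine Finset.sum_eq_zero fun k hk => ?_
    rw [hHoff k j (Finset.ne_of_mem_erase hk), ← neg_sub (Λ j) (Λ k), one_div_neg_eq_neg_one_div,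
      add_neg_cancel]
  ext i j
  simp only [Matrix.sub_apply, diagonal_mul, mul_diagonal, Matrix.smul_apply, of_apply,
    smul_eq_mul]
  obtain rfl | hij := eq_or_ne i j
  · rw [one_apply_eq]
    ring
  · rw [one_apply_ne hij]
    linear_combination sq_sub_mul_transpose_mul_self_apply hinj hHoff hcol hij
end

section
/- Let J, F, G : ℝ → M_n(ℝ) be matrix-valued functions with J differentiable, F and G continuous, such that for every x the derivative satisfies J'(x) = F(x) + G(x)·J(x) − J(x)·G(x) and F(x) commutes with J(x). Then for every integer m ≥ 1 the function x ↦ J(x)^m is differentiable with derivative m·J(x)^{m−1}·F(x) + G(x)·J(x)^m − J(x)^m·G(x). -/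
/-- The product rule for matrix-valued functions, entrywise. -/
theorem Matrix.hasDerivAt_mul_apply {l m n : Type*} [Fintype m]
    {A : ℝ → Matrix l m ℝ} {B : ℝ → Matrix m n ℝ} {A' : Matrix l m ℝ} {B' : Matrix m n ℝ} {x : ℝ}
    (hA : ∀ i j, HasDerivAt (fun t => A t i j) (A' i j) x)
    (hB : ∀ i j, HasDerivAt (fun t => B t i j) (B' i j) x) (i : l) (j : n) :
    HasDerivAt (fun t => (A t * B t) i j) ((A' * B x + A x * B') i j) x := by
  simp only [Matrix.add_apply, Matrix.mul_apply, ← Finset.sum_add_distrib]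
  exact HasDerivAt.fun_sum fun k _ => (hA i k).fun_mul (hB k j)

/-- Under the FG flow `J' = F + [G, J]` with `F` commuting with `J`, the powers of `J`
evolve according to `(Jᵐ)' = m Jᵐ⁻¹ F + [G, Jᵐ]` (derivatives taken entrywise). -/
theorem fg_flow_powers
    (n : ℕ) (J J' F G : ℝ → Matrix (Fin n) (Fin n) ℝ)
    (hJ : ∀ x i j, HasDerivAt (fun t => J t i j) (J' x i j) x)
    (hF : ∀ i j, Continuous fun x => F x i j)
    (hG : ∀ i j, Continuous fun x => G x i j)
    (hDeriv : ∀ x, J' x = F x + (G x * J x - J x * G x))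
    (hComm : ∀ x, F x * J x = J x * F x) :
    ∀ m : ℕ, 1 ≤ m → ∀ x i j,
      HasDerivAt (fun t => (J t ^ m) i j)
        (((m : ℝ) • (J x ^ (m - 1) * F x) + (G x * J x ^ m - J x ^ m * G x)) i j) x := by
  intro m hm x
  induction m, hm using Nat.le_induction with
  | base => simpa [hDeriv] using hJ x
  | succ m hm ih =>
    intro i j
    have hFJ : J x ^ (m - 1) * F x * J x = J x ^ m * F x := by
      rw [mul_assoc, hComm, ← mul_assoc, pow_sub_one_mul (by lia)]
    have hsum : ((m + 1 : ℕ) : ℝ) • (J x ^ (m + 1 - 1) * F x)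
          + (G x * J x ^ (m + 1) - J x ^ (m + 1) * G x)
        = ((m : ℝ) • (J x ^ (m - 1) * F x) + (G x * J x ^ m - J x ^ m * G x)) * J x
          + J x ^ m * J' x := by
      rw [hDeriv, add_mul, smul_mul_assoc, hFJ, Nat.add_sub_cancel, pow_succ, Nat.cast_succ,
        add_smul, one_smul]
      simp only [mul_add, mul_sub, sub_mul, mul_assoc]
      abel
    rw [hsum]
    simpa only [← pow_succ] using Matrix.hasDerivAt_mul_apply ih (hJ x) i j
end
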